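/- arXiv:1804.06290 — 2 statements merged into one kernel-verified Lean document; each statement's English description precedes it below -/
import Mathlib

section
/- Let m ≥ 1, R > 1, let W_{i₁},...,W_{i_m} be positive integers, and let 𝓔_m = {e ∈ ℕ^m : ∏_j e_j < R^{1/3}, ∏_j e_j squarefree, gcd(e_j, W_{i_j}) = 1 for all j}. Let c > 0 and define λ̃_e = φ(e) μ(e) ∑_{r₀ ∈ ℕ^m : r₀ ∈ 𝓔_m, e_j | r_{0_j} ∀j} c/φ(r₀) for e ∈ 𝓔_m and λ̃_e = 0 for e ∉ 𝓔_m, where e = ∏_j e_j and r₀ = ∏_j r_{0_j}. Then for every e ∈ ℕ^m, |λ̃_e| ≤ λ̃_{(1,...,1)} = ∑_{r₀ ∈ 𝓔_m} c·μ²(r₀)/φ(r₀). -/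
open scoped BigOperators

attribute [local instance] Classical.propDecidable

namespace Sieve

/-- `𝓔_m = {e ∈ ℕ^m : ∏ e j < R^{1/3}, ∏ e j squarefree, gcd (e j) (Wi j) = 1 ∀ j}`. -/
def Em (m : ℕ) (R : ℝ) (Wi : Fin m → ℕ) : Set (Fin m → ℕ) :=
  {e | ((∏ j, e j : ℕ) : ℝ) < R ^ ((1 : ℝ) / 3) ∧ Squarefree (∏ j, e j) ∧
    ∀ j, Nat.Coprime (e j) (Wi j)}

/-- `λ̃_e = φ(e) μ(e) ∑_{e ∣ r₀ ∈ 𝓔_m} c / φ(r₀)` for `e ∈ 𝓔_m`, and `0` otherwise. -/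
noncomputable def lamT (m : ℕ) (R : ℝ) (Wi : Fin m → ℕ) (c : ℝ) (e : Fin m → ℕ) : ℝ :=
  if e ∈ Em m R Wi then
    (Nat.totient (∏ j, e j) : ℝ) * (ArithmeticFunction.moebius (∏ j, e j) : ℝ) *
      ∑' r : Fin m → ℕ,
        if r ∈ Em m R Wi ∧ ∀ j, e j ∣ r j then c / (Nat.totient (∏ j, r j) : ℝ) else 0
  else 0

lemma Em_finite (m : ℕ) (R : ℝ) (Wi : Fin m → ℕ) : (Em m R Wi).Finite := by
  apply (Set.finite_Iic (fun _ : Fin m => ⌈R ^ ((1 : ℝ) / 3)⌉₊)).subset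
  rintro e ⟨h1, h2, -⟩ j
  have hd : e j ≤ ∏ j, e j :=
    Nat.le_of_dvd (Nat.pos_of_ne_zero h2.ne_zero) (Finset.dvd_prod_of_mem _ (Finset.mem_univ j))
  have h3 : ((∏ j, e j : ℕ) : ℝ) ≤ (⌈R ^ ((1 : ℝ) / 3)⌉₊ : ℝ) := h1.le.trans (Nat.le_ceil _)
  exact hd.trans (by exact_mod_cast h3)

lemma summable_Em (m : ℕ) (R : ℝ) (Wi : Fin m → ℕ) (f : (Fin m → ℕ) → ℝ)
    (hf : ∀ r, r ∉ Em m R Wi → f r = 0) : Summable f := by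
  apply summable_of_hasFiniteSupport
  apply (Em_finite m R Wi).subset
  intro r hr
  by_contra h
  exact hr (hf r h)

lemma one_mem (m : ℕ) (R : ℝ) (hR : 1 < R) (Wi : Fin m → ℕ) :
    (fun _ => 1) ∈ Em m R Wi := by
  refine ⟨?_, ?_, ?_⟩
  · simpa using Real.one_lt_rpow hR (by norm_num : (0 : ℝ) < 1 / 3)
  · simp
  · simp

lemma lamT_one (m : ℕ) (R : ℝ) (hR : 1 < R) (Wi : Fin m → ℕ) (c : ℝ) :
    lamT m R Wi c (fun _ => 1) =
      ∑' r : Fin m → ℕ, if r ∈ Em m R Wi then c / (Nat.totient (∏ j, r j) : ℝ) else 0 := by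
  unfold lamT
  rw [if_pos (one_mem m R hR Wi)]
  simp

lemma key (m : ℕ) (R : ℝ) (Wi : Fin m → ℕ) (c : ℝ) (hc : 0 < c) (e : Fin m → ℕ)
    (he : e ∈ Em m R Wi) :
    (Nat.totient (∏ j, e j) : ℝ) * (∑' r : Fin m → ℕ,
        if r ∈ Em m R Wi ∧ ∀ j, e j ∣ r j then c / (Nat.totient (∏ j, r j) : ℝ) else 0) ≤
      ∑' r : Fin m → ℕ, if r ∈ Em m R Wi then c / (Nat.totient (∏ j, r j) : ℝ) else 0 := by
  have hE0 : ∏ j, e j ≠ 0 := he.2.1.ne_zero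
  have he0 : ∀ j, e j ≠ 0 := fun j => Finset.prod_ne_zero_iff.1 hE0 j (Finset.mem_univ j)
  have hinj : Function.Injective (fun s : Fin m → ℕ => e * s) := by
    intro s t hst
    funext j
    exact Nat.eq_of_mul_eq_mul_left (Nat.pos_of_ne_zero (he0 j)) (congrFun hst j)
  rw [← hinj.tsum_eq, ← tsum_mul_left]
  · have hterm : ∀ s : Fin m → ℕ, (Nat.totient (∏ j, e j) : ℝ) *
        (if e * s ∈ Em m R Wi ∧ ∀ j, e j ∣ (e * s) j then
          c / (Nat.totient (∏ j, (e * s) j) : ℝ) else 0) ≤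
        if s ∈ Em m R Wi then c / (Nat.totient (∏ j, s j) : ℝ) else 0 := by
      intro s
      by_cases h : e * s ∈ Em m R Wi
      · have hp : ∏ j, (e * s) j = (∏ j, e j) * ∏ j, s j := by
          simp [Finset.prod_mul_distrib]
        obtain ⟨h1, h2, h3⟩ := h
        have h4 := h2
        rw [hp] at h4
        have hs : s ∈ Em m R Wi := by
          refine ⟨lt_of_le_of_lt ?_ h1, h4.of_mul_right, fun j => (h3 j).coprime_mul_left⟩
          rw [hp]
          exact_mod_cast Nat.le_mul_of_pos_left _ (Nat.pos_of_ne_zero hE0)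
        rw [if_pos hs, if_pos ⟨⟨h1, h2, h3⟩, fun j => by simp⟩, hp,
          Nat.totient_mul (Nat.coprime_of_squarefree_mul h4)]
        have a : (Nat.totient (∏ j, e j) : ℝ) ≠ 0 := by
          exact_mod_cast (Nat.totient_pos.2 (Nat.pos_of_ne_zero hE0)).ne'
        have b : (Nat.totient (∏ j, s j) : ℝ) ≠ 0 := by
          exact_mod_cast (Nat.totient_pos.2 (Nat.pos_of_ne_zero hs.2.1.ne_zero)).ne'
        apply le_of_eq
        push_cast
        field_simp
      · rw [if_neg (fun hh => h hh.1), mul_zero]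
        split_ifs <;> positivity
    have hs2 : Summable (fun s : Fin m → ℕ =>
        if s ∈ Em m R Wi then c / (Nat.totient (∏ j, s j) : ℝ) else 0) :=
      summable_Em m R Wi _ (fun r hr => if_neg hr)
    refine Summable.tsum_le_tsum hterm (Summable.of_nonneg_of_le ?_ hterm hs2) hs2
    intro s
    split_ifs <;> positivity
  · intro r hr
    by_cases h : ∀ j, e j ∣ r j
    · choose s hs using h
      exact ⟨s, by funext j; simp [hs j]⟩
    · exact absurd (if_neg (fun hh => h hh.2)) hr

theorem lamT_le_lamT_one
    (m : ℕ) (hm : 1 ≤ m) (R : ℝ) (hR : 1 < R)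
    (Wi : Fin m → ℕ) (hWi : ∀ j, 0 < Wi j) (c : ℝ) (hc : 0 < c) :
    (∀ e : Fin m → ℕ, |lamT m R Wi c e| ≤ lamT m R Wi c (fun _ => 1)) ∧
    lamT m R Wi c (fun _ => 1) =
      ∑' r : Fin m → ℕ,
        if r ∈ Em m R Wi then
          c * (ArithmeticFunction.moebius (∏ j, r j) : ℝ) ^ 2 / (Nat.totient (∏ j, r j) : ℝ)
        else 0 := by
  rw [lamT_one m R hR Wi c]
  refine ⟨?_, ?_⟩
  · intro e
    by_cases he : e ∈ Em m R Wi
    · refine le_trans (le_of_eq ?_) (key m R Wi c hc e he)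
      have hnn : 0 ≤ ∑' r : Fin m → ℕ, (if r ∈ Em m R Wi ∧ ∀ j, e j ∣ r j then
          c / (Nat.totient (∏ j, r j) : ℝ) else 0) := by
        apply tsum_nonneg
        intro r
        split_ifs <;> positivity
      have hmu : |(ArithmeticFunction.moebius (∏ j, e j) : ℝ)| = 1 := by
        exact_mod_cast ArithmeticFunction.abs_moebius_eq_one_of_squarefree he.2.1
      unfold lamT
      rw [if_pos he, abs_mul, abs_mul, hmu, mul_one, abs_of_nonneg hnn, Nat.abs_cast]
    · unfold lamT
      rw [if_neg he, abs_zero]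
      apply tsum_nonneg
      intro r
      split_ifs <;> positivity
  · apply tsum_congr
    intro r
    by_cases hr : r ∈ Em m R Wi
    · have hmu : (ArithmeticFunction.moebius (∏ j, r j) : ℝ) ^ 2 = 1 := by
        exact_mod_cast ArithmeticFunction.moebius_sq_eq_one_of_squarefree hr.2.1
      rw [if_pos hr, if_pos hr, hmu, mul_one]
    · rw [if_neg hr, if_neg hr]

end Sieve
end

section
/- Fix an integer m ≥ 1 and a smooth non-increasing function ψ : [0,∞) → [0,1] supported on [0,1] with ψ = 1 on [0, 9/10]. There exist constants C > 0 and k₀ (depending only on m and ψ) such that for every integer k ≥ k₀: L_k(F₁) ≤ C · ((log k)^{m+1}/k^{m+1}) · I_k(F), where L_k(F₁) = ∫_{[0,∞)^{k−m−1}} ( ∫_{[0,∞)^{m+1}} F₁(t₁,...,t_k) dt₁⋯dt_{m+1} )² dt_{m+2}⋯dt_k and I_k(F) = ∫_{[0,∞)^k} F(t)² dt. -/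
open scoped BigOperators
open MeasureTheory

namespace Sieve

/-- `F(t) = ψ(∑ t i) ∏ i, ψ(t i / U_k)/(1 + T_k t i)` with `T_k = k log k`, `U_k = k^{-1/2}`. -/
noncomputable def Ffun (k : ℕ) (ψ : ℝ → ℝ) (t : Fin k → ℝ) : ℝ :=
  ψ (∑ i, t i) * ∏ i, ψ (t i / (Real.sqrt k)⁻¹) / (1 + ((k : ℝ) * Real.log k) * t i)

/-- `F₁(t) = ∏ i, ψ(t i / U_k)/(1 + T_k t i)`. -/
noncomputable def F1 (k : ℕ) (ψ : ℝ → ℝ) (t : Fin k → ℝ) : ℝ :=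
  ∏ i, ψ (t i / (Real.sqrt k)⁻¹) / (1 + ((k : ℝ) * Real.log k) * t i)


/-- one-variable factor -/
noncomputable def gf (k : ℕ) (ψ : ℝ → ℝ) (t : ℝ) : ℝ :=
  ψ (t / (Real.sqrt k)⁻¹) / (1 + ((k : ℝ) * Real.log k) * t)

lemma cond_eventually : ∃ k₀ : ℕ, ∀ k : ℕ, k₀ ≤ k →
    1 ≤ k ∧ 0 < Real.log k ∧ 10 ≤ Real.sqrt k * Real.log k ∧
    Real.log (1 + Real.sqrt k * Real.log k) ≤ (6/10) * Real.log k := by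
  have h1 : ∀ᶠ x : ℝ in Filter.atTop, Real.log x ≤ (1/2) * x ^ (1/10 : ℝ) := by
    have := (isLittleO_log_rpow_atTop (r := 1/10) (by norm_num)).bound
      (show (0:ℝ) < 1/2 by norm_num)
    filter_upwards [this, Filter.eventually_ge_atTop 1] with x hx h1
    rw [Real.norm_of_nonneg (Real.log_nonneg h1), Real.norm_of_nonneg (by positivity)] at hx
    exact hx
  have h2 : ∀ᶠ x : ℝ in Filter.atTop, (2:ℝ) ≤ x ^ (6/10 : ℝ) :=
    (tendsto_rpow_atTop (by norm_num)).eventually_ge_atTop 2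
  have h3 : ∀ᶠ x : ℝ in Filter.atTop, (1:ℝ) ≤ Real.log x :=
    Real.tendsto_log_atTop.eventually_ge_atTop 1
  have h4 : ∀ᶠ x : ℝ in Filter.atTop, (100:ℝ) ≤ x := Filter.eventually_ge_atTop 100
  have h := tendsto_natCast_atTop_atTop.eventually ((h1.and h2).and (h3.and h4))
  obtain ⟨k₀, hk⟩ := Filter.eventually_atTop.1 h
  refine ⟨k₀, fun k hkk => ?_⟩
  obtain ⟨⟨a1, a2⟩, a3, a4⟩ := hk k hkk
  have hpos : (0:ℝ) < k := by linarith
  have hs : (10:ℝ) ≤ Real.sqrt k := by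
    apply Real.le_sqrt_of_sq_le; linarith
  refine ⟨by exact_mod_cast hpos, by linarith, by nlinarith, ?_⟩
  rw [← Real.log_rpow hpos (6/10)]
  apply Real.log_le_log (by positivity)
  have e : Real.sqrt k * (k:ℝ) ^ (1/10 : ℝ) = (k:ℝ) ^ (6/10 : ℝ) := by
    rw [Real.sqrt_eq_rpow, ← Real.rpow_add hpos]; norm_num
  nlinarith [mul_le_mul_of_nonneg_left a1 (Real.sqrt_nonneg (k:ℝ))]

lemma int_inv (T b : ℝ) (hT : 0 < T) (hb : 0 ≤ b) :
    ∫ t in Set.Icc 0 b, 1 / (1 + T * t) = Real.log (1 + T * b) / T := by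
  rw [integral_Icc_eq_integral_Ioc, ← intervalIntegral.integral_of_le hb]
  rw [intervalIntegral.integral_eq_sub_of_hasDerivAt (f := fun t => Real.log (1 + T * t) / T)]
  · simp
  · intro x hx
    rw [Set.uIcc_of_le hb] at hx
    have hp : 0 < 1 + T * x := by have := mul_nonneg hT.le hx.1; linarith
    have := ((((hasDerivAt_id x).const_mul T).const_add 1).log hp.ne').div_const T
    exact this.congr_deriv (by simp only [id]; field_simp)
  · apply ContinuousOn.intervalIntegrable
    rw [Set.uIcc_of_le hb]
    apply ContinuousOn.div (by fun_prop) (by fun_prop)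
    intro x hx
    have := mul_nonneg hT.le hx.1; positivity

lemma int_inv_sq (T b : ℝ) (hT : 0 < T) (hb : 0 ≤ b) :
    ∫ t in Set.Icc 0 b, 1 / (1 + T * t) ^ 2 = (1 - 1 / (1 + T * b)) / T := by
  rw [integral_Icc_eq_integral_Ioc, ← intervalIntegral.integral_of_le hb]
  rw [intervalIntegral.integral_eq_sub_of_hasDerivAt (f := fun t => - (1 + T * t)⁻¹ / T)]
  · simp; ring
  · intro x hx
    rw [Set.uIcc_of_le hb] at hx
    have hp : 0 < 1 + T * x := by have := mul_nonneg hT.le hx.1; linarith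
    have := ((((hasDerivAt_id x).const_mul T).const_add 1).inv hp.ne').neg.div_const T
    exact this.congr_deriv (by simp only [id]; field_simp)
  · apply ContinuousOn.intervalIntegrable
    rw [Set.uIcc_of_le hb]
    apply ContinuousOn.div (by fun_prop) (by fun_prop)
    intro x hx
    have := mul_nonneg hT.le hx.1; positivity

lemma intOn (f : ℝ → ℝ) (b : ℝ) (hb : 0 ≤ b) (hf : ContinuousOn f (Set.Icc 0 b))
    (h0 : ∀ t, b < t → f t = 0) : IntegrableOn f (Set.Ici 0) := by
  have : Set.Ici (0:ℝ) = Set.Icc 0 b ∪ Set.Ioi b := by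
    rw [Set.Icc_union_Ioi_eq_Ici hb]
  rw [this]
  apply IntegrableOn.union hf.integrableOn_Icc
  exact (integrableOn_zero : IntegrableOn (fun _ => (0:ℝ)) (Set.Ioi b) volume).congr_fun
    (fun t ht => (h0 t ht).symm) measurableSet_Ioi

lemma int_restrict (f : ℝ → ℝ) (b : ℝ) (h0 : ∀ t, b < t → f t = 0) :
    ∫ t in Set.Ici 0, f t = ∫ t in Set.Icc 0 b, f t := by
  apply setIntegral_eq_of_subset_of_forall_sdiff_eq_zero measurableSet_Ici Set.Icc_subset_Ici_self
  intro x hx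
  apply h0
  by_contra h
  exact hx.2 ⟨hx.1, not_lt.1 h⟩

lemma pi_restrict (n : ℕ) :
    (volume : Measure (Fin n → ℝ)).restrict (Set.univ.pi fun _ : Fin n => Set.Ici (0 : ℝ)) =
    Measure.pi fun _ : Fin n => (volume : Measure ℝ).restrict (Set.Ici 0) := by
  rw [volume_pi, Measure.restrict_pi_pi]

lemma one_dim (k : ℕ) (ψ : ℝ → ℝ) (hc : Continuous ψ)
    (hψrange : ∀ a : ℝ, 0 ≤ a → ψ a ∈ Set.Icc (0 : ℝ) 1)
    (hψsupp : ∀ a : ℝ, 1 < a → ψ a = 0)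
    (hψone : ∀ a : ℝ, 0 ≤ a → a ≤ 9 / 10 → ψ a = 1)
    (hk : 1 ≤ k) (hL : 0 < Real.log k) (h10 : 10 ≤ Real.sqrt k * Real.log k)
    (hlog : Real.log (1 + Real.sqrt k * Real.log k) ≤ (6/10) * Real.log k) :
    IntegrableOn (gf k ψ) (Set.Ici 0) ∧ IntegrableOn (fun t => gf k ψ t ^ 2) (Set.Ici 0) ∧
    IntegrableOn (fun t => t * gf k ψ t ^ 2) (Set.Ici 0) ∧
    0 ≤ (∫ t in Set.Ici 0, gf k ψ t) ∧
    (∫ t in Set.Ici 0, gf k ψ t) ≤ 1 / k ∧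
    (9/10) / (k * Real.log k) ≤ (∫ t in Set.Ici 0, gf k ψ t ^ 2) ∧
    (∫ t in Set.Ici 0, t * gf k ψ t ^ 2) ≤
      2 / (3 * k) * (∫ t in Set.Ici 0, gf k ψ t ^ 2) := by
  have hk0 : (0:ℝ) < k := by exact_mod_cast hk
  have hsq : 0 < Real.sqrt k := Real.sqrt_pos.2 hk0
  set T : ℝ := k * Real.log k with hTdef
  have hT : 0 < T := by positivity
  set U : ℝ := (Real.sqrt k)⁻¹ with hUdef
  have hU : 0 < U := by positivity
  have hTU : T * U = Real.sqrt k * Real.log k := by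
    rw [hTdef, hUdef]; field_simp
    rw [Real.sq_sqrt hk0.le]
  have hg : ∀ t, gf k ψ t = ψ (t / U) / (1 + T * t) := fun t => rfl
  have hden : ∀ t : ℝ, 0 ≤ t → 0 < 1 + T * t := fun t ht => by
    have := mul_nonneg hT.le ht; linarith
  have hgz : ∀ t, U < t → gf k ψ t = 0 := by
    intro t ht
    rw [hg, hψsupp _ ((one_lt_div hU).2 ht), zero_div]
  have hgc : ContinuousOn (gf k ψ) (Set.Icc 0 U) := by
    have : gf k ψ = fun t => ψ (t / U) / (1 + T * t) := funext hg
    rw [this]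
    apply ContinuousOn.div (by fun_prop) (by fun_prop)
    intro x hx
    exact (hden x hx.1).ne'
  have hg0 : ∀ t, 0 ≤ t → 0 ≤ gf k ψ t := by
    intro t ht
    rw [hg]
    exact div_nonneg (hψrange _ (by positivity)).1 (hden t ht).le
  have hg1 : ∀ t, 0 ≤ t → gf k ψ t ≤ 1 / (1 + T * t) := by
    intro t ht
    rw [hg]
    exact div_le_div_of_nonneg_right (hψrange _ (by positivity)).2 (hden t ht).le
  have hI1 := intOn (gf k ψ) U hU.le hgc hgz
  have hI2 := intOn (fun t => gf k ψ t ^ 2) U hU.le (hgc.pow 2)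
    (fun t ht => by simp [hgz t ht])
  have hI3 := intOn (fun t => t * gf k ψ t ^ 2) U hU.le (continuousOn_id.mul (hgc.pow 2))
    (fun t ht => by simp [hgz t ht])
  have hinv : IntegrableOn (fun t => 1 / (1 + T * t)) (Set.Icc 0 U) := by
    apply ContinuousOn.integrableOn_Icc
    apply ContinuousOn.div (by fun_prop) (by fun_prop)
    intro x hx
    exact (hden x hx.1).ne'
  have hA : (∫ t in Set.Ici 0, gf k ψ t) ≤ Real.log (1 + T * U) / T := by
    rw [int_restrict _ U hgz, ← int_inv T U hT hU.le]
    exact setIntegral_mono_on (hI1.mono_set Set.Icc_subset_Ici_self) hinv measurableSet_Icc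
      (fun t ht => hg1 t ht.1)
  have hM : (∫ t in Set.Ici 0, t * gf k ψ t ^ 2) ≤ (1 / T) * (Real.log (1 + T * U) / T) := by
    rw [int_restrict _ U (fun t ht => by simp [hgz t ht]), ← int_inv T U hT hU.le,
      ← integral_const_mul]
    apply setIntegral_mono_on (hI3.mono_set Set.Icc_subset_Ici_self) (hinv.const_mul _)
      measurableSet_Icc
    intro t ht
    have hd := hden t ht.1
    have h1 := hg1 t ht.1
    have h0 := hg0 t ht.1
    calc t * gf k ψ t ^ 2 ≤ t * (1 / (1 + T * t)) ^ 2 := by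
          have := ht.1
          gcongr
      _ ≤ (1 / T) * (1 / (1 + T * t)) := by
          rw [div_mul_div_comm, div_pow, ← mul_div_assoc, div_le_div_iff₀ (by positivity) (by positivity)]
          nlinarith
  have hB : (9/10) / T ≤ (∫ t in Set.Ici 0, gf k ψ t ^ 2) := by
    have hV : (0:ℝ) ≤ 9/10 * U := by positivity
    calc (9/10) / T ≤ (1 - 1 / (1 + T * (9/10 * U))) / T := by
          gcongr
          have e : T * (9/10 * U) = 9/10 * (Real.sqrt k * Real.log k) := by rw [← hTU]; ring
          rw [e]
          have : 1 / (1 + 9/10 * (Real.sqrt k * Real.log k)) ≤ 1 / 10 := by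
            apply one_div_le_one_div_of_le <;> linarith
          linarith
      _ = ∫ t in Set.Icc 0 (9/10 * U), 1 / (1 + T * t) ^ 2 := (int_inv_sq T _ hT hV).symm
      _ = ∫ t in Set.Icc 0 (9/10 * U), gf k ψ t ^ 2 := by
          apply setIntegral_congr_fun measurableSet_Icc
          intro t ht
          have : ψ (t / U) = 1 := hψone _ (div_nonneg ht.1 hU.le) ((div_le_iff₀ hU).2 ht.2)
          simp [hg, this]
      _ ≤ _ := by
          apply setIntegral_mono_set hI2
          · exact Filter.Eventually.of_forall fun t => sq_nonneg _
          · exact Set.Icc_subset_Ici_self.eventuallyLE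
  rw [hTU] at hA hM
  refine ⟨hI1, hI2, hI3, setIntegral_nonneg measurableSet_Ici hg0, ?_, hB, ?_⟩
  · refine hA.trans ?_
    rw [div_le_div_iff₀ hT hk0, hTdef]
    nlinarith
  · refine hM.trans ?_
    calc (1 / T) * (Real.log (1 + Real.sqrt k * Real.log k) / T)
        ≤ (1 / T) * ((6/10) * Real.log k / T) := by gcongr
      _ = 2 / (3 * k) * ((9/10) / T) := by
          rw [hTdef]; field_simp; norm_num
      _ ≤ _ := by gcongr

lemma lower (n : ℕ) (hn : 1 ≤ n) (ψ g : ℝ → ℝ) (hc : Continuous ψ)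
    (hψrange : ∀ a : ℝ, 0 ≤ a → ψ a ∈ Set.Icc (0 : ℝ) 1)
    (hψone : ∀ a : ℝ, 0 ≤ a → a ≤ 9 / 10 → ψ a = 1)
    (hI2 : IntegrableOn (fun t => g t ^ 2) (Set.Ici 0))
    (hI3 : IntegrableOn (fun t => t * g t ^ 2) (Set.Ici 0))
    (hM : (∫ t in Set.Ici 0, t * g t ^ 2) ≤ 2 / (3 * n) * (∫ t in Set.Ici 0, g t ^ 2)) :
    (1/4) * (∫ t in Set.Ici 0, g t ^ 2) ^ n ≤
    ∫ t in Set.univ.pi fun _ : Fin n => Set.Ici (0 : ℝ), (ψ (∑ i, t i) * ∏ i, g (t i)) ^ 2 := by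
  have hn0 : (0:ℝ) < n := by exact_mod_cast hn
  have hae : ∀ᵐ t ∂(Measure.pi fun _ : Fin n => (volume : Measure ℝ).restrict (Set.Ici 0)),
      ∀ i, 0 ≤ t i := by
    rw [← pi_restrict]
    filter_upwards [ae_restrict_mem (MeasurableSet.univ_pi fun _ => measurableSet_Ici)] with t ht i
    exact ht i trivial
  rw [pi_restrict]
  set μ : Measure (Fin n → ℝ) :=
    Measure.pi fun _ : Fin n => (volume : Measure ℝ).restrict (Set.Ici 0) with hμ
  set B := ∫ t in Set.Ici 0, g t ^ 2 with hBdef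
  have hB0 : 0 ≤ B := setIntegral_nonneg measurableSet_Ici fun t _ => sq_nonneg _
  have hM0 : 0 ≤ ∫ t in Set.Ici 0, t * g t ^ 2 :=
    setIntegral_nonneg measurableSet_Ici fun t ht => mul_nonneg ht (sq_nonneg _)
  have hP : Integrable (fun t : Fin n → ℝ => ∏ i, g (t i) ^ 2) μ :=
    Integrable.fintype_prod (f := fun _ : Fin n => fun t => g t ^ 2) (fun _ => hI2)
  have hPi : ∫ t, ∏ i, g (t i) ^ 2 ∂μ = B ^ n := by
    rw [hμ, integral_fintype_prod_eq_prod (fun _ : Fin n => fun t => g t ^ 2)]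
    simp [hBdef]
  have hrew : ∀ (i : Fin n) (t : Fin n → ℝ), t i * ∏ j, g (t j) ^ 2 =
      ∏ j, (if j = i then (fun x : ℝ => x * g x ^ 2) else fun x => g x ^ 2) (t j) := by
    intro i t
    have : ∀ j, (if j = i then (fun x : ℝ => x * g x ^ 2) else fun x => g x ^ 2) (t j)
        = (if j = i then t j else 1) * g (t j) ^ 2 := by
      intro j; split_ifs <;> simp
    simp only [this, Finset.prod_mul_distrib, Finset.prod_ite_eq', Finset.mem_univ, if_true]
  have hQ : ∀ i : Fin n, Integrable (fun t : Fin n → ℝ => t i * ∏ j, g (t j) ^ 2) μ := by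
    intro i
    simp only [hrew]
    apply Integrable.fintype_prod
      (f := fun j : Fin n => if j = i then (fun x : ℝ => x * g x ^ 2) else fun x => g x ^ 2)
    intro j
    split_ifs
    · exact hI3
    · exact hI2
  have hQi : ∀ i : Fin n, ∫ t, t i * ∏ j, g (t j) ^ 2 ∂μ ≤ 2 / (3 * n) * B ^ n := by
    intro i
    simp only [hrew]
    rw [hμ, integral_fintype_prod_eq_prod
      (fun j : Fin n => if j = i then (fun x : ℝ => x * g x ^ 2) else fun x => g x ^ 2)]
    calc _ ≤ ∏ j : Fin n, ((if j = i then 2 / (3 * (n:ℝ)) else 1) * B) := by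
          apply Finset.prod_le_prod
          · intro j _
            split_ifs
            · exact hM0
            · exact hB0
          · intro j _
            split_ifs
            · exact hM
            · rw [one_mul]
      _ = _ := by
          rw [Finset.prod_mul_distrib]
          simp
  have hlowI : Integrable (fun t : Fin n → ℝ => ∏ i, g (t i) ^ 2 -
      (10/9) * ∑ i, t i * ∏ j, g (t j) ^ 2) μ :=
    hP.sub ((integrable_finsetSum _ fun i _ => hQ i).const_mul _)
  have hlow : (1/4) * B ^ n ≤ ∫ t, (∏ i, g (t i) ^ 2 -
      (10/9) * ∑ i, t i * ∏ j, g (t j) ^ 2) ∂μ := by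
    rw [integral_sub hP ((integrable_finsetSum _ fun i _ => hQ i).const_mul _), hPi,
      integral_const_mul, integral_finsetSum _ fun i _ => hQ i]
    have : ∑ i : Fin n, ∫ t, t i * ∏ j, g (t j) ^ 2 ∂μ ≤ 2 / 3 * B ^ n := by
      calc _ ≤ ∑ i : Fin n, 2 / (3 * (n:ℝ)) * B ^ n := Finset.sum_le_sum fun i _ => hQi i
        _ = _ := by simp; field_simp
    have := pow_nonneg hB0 n
    linarith
  refine hlow.trans (integral_mono_ae hlowI ?_ ?_)
  · apply Integrable.mono' hP
    · have : (fun t : Fin n → ℝ => (ψ (∑ i, t i) * ∏ i, g (t i)) ^ 2) =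
        fun t => (ψ (∑ i, t i)) ^ 2 * ∏ i, g (t i) ^ 2 := by
        funext t; rw [mul_pow, Finset.prod_pow]
      rw [this]
      exact (Continuous.aestronglyMeasurable (by fun_prop)).mul hP.1
    · filter_upwards [hae] with t ht
      rw [Real.norm_of_nonneg (sq_nonneg _), mul_pow, ← Finset.prod_pow]
      have h := hψrange (∑ i, t i) (Finset.sum_nonneg fun i _ => ht i)
      exact mul_le_of_le_one_left (Finset.prod_nonneg fun i _ => sq_nonneg _)
        (pow_le_one₀ h.1 h.2)
  · filter_upwards [hae] with t ht
    have hs := Finset.sum_nonneg fun i (_ : i ∈ Finset.univ) => ht i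
    have hp : 0 ≤ ∏ i, g (t i) ^ 2 := Finset.prod_nonneg fun i _ => sq_nonneg _
    show _ ≤ _
    rw [mul_pow, ← Finset.prod_pow, ← Finset.sum_mul]
    have : 1 - (10/9) * ∑ i, t i ≤ ψ (∑ i, t i) ^ 2 := by
      by_cases h : ∑ i, t i ≤ 9/10
      · rw [hψone _ hs h]; linarith
      · have := sq_nonneg (ψ (∑ i, t i)); push Not at h; linarith
    nlinarith [mul_le_mul_of_nonneg_right this hp]

lemma upper (m l : ℕ) (g : ℝ → ℝ) :
    (∫ s in Set.univ.pi fun _ : Fin l => Set.Ici (0 : ℝ),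
        (∫ u in Set.univ.pi fun _ : Fin (m + 1) => Set.Ici (0 : ℝ),
          ∏ i, g (Fin.append u s i)) ^ 2) =
    (∫ t in Set.Ici 0, g t) ^ (2 * (m + 1)) * (∫ t in Set.Ici 0, g t ^ 2) ^ l := by
  have h1 : ∀ s : Fin l → ℝ, (∫ u in Set.univ.pi fun _ : Fin (m + 1) => Set.Ici (0 : ℝ),
          ∏ i, g (Fin.append u s i)) = (∫ t in Set.Ici 0, g t) ^ (m + 1) * ∏ j, g (s j) := by
    intro s
    simp only [@Fin.prod_univ_add _ _ (m + 1) l, Fin.append_left, Fin.append_right]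
    rw [integral_mul_const, pi_restrict, integral_fintype_prod_eq_prod (fun _ => g)]
    simp
  simp only [h1, mul_pow, ← Finset.prod_pow]
  rw [integral_const_mul, pi_restrict,
    integral_fintype_prod_eq_prod (fun _ : Fin l => fun t => g t ^ 2)]
  simp
  left
  ring

theorem L_F1_bound
    (m : ℕ) (hm : 1 ≤ m)
    (ψ : ℝ → ℝ) (hψsmooth : ContDiff ℝ (⊤ : ℕ∞) ψ)
    (hψmono : ∀ a b : ℝ, 0 ≤ a → a ≤ b → ψ b ≤ ψ a)
    (hψrange : ∀ a : ℝ, 0 ≤ a → ψ a ∈ Set.Icc (0 : ℝ) 1)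
    (hψsupp : ∀ a : ℝ, 1 < a → ψ a = 0)
    (hψone : ∀ a : ℝ, 0 ≤ a → a ≤ 9 / 10 → ψ a = 1) :
    ∃ C : ℝ, 0 < C ∧ ∃ k₀ : ℕ, ∀ l : ℕ, k₀ ≤ m + 1 + l →
      (∫ s in Set.univ.pi fun _ : Fin l => Set.Ici (0 : ℝ),
        (∫ u in Set.univ.pi fun _ : Fin (m + 1) => Set.Ici (0 : ℝ),
          F1 (m + 1 + l) ψ (Fin.append u s)) ^ 2) ≤
      C * (Real.log (m + 1 + l : ℕ) ^ (m + 1) / ((m + 1 + l : ℕ) : ℝ) ^ (m + 1)) *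
        ∫ t in Set.univ.pi fun _ : Fin (m + 1 + l) => Set.Ici (0 : ℝ),
          Ffun (m + 1 + l) ψ t ^ 2 := by
  obtain ⟨k₀, hk₀⟩ := cond_eventually
  refine ⟨4 * 2 ^ (m + 1), by positivity, k₀, fun l hl => ?_⟩
  obtain ⟨hk, hL, h10, hlog⟩ := hk₀ _ hl
  obtain ⟨-, hI2, hI3, hA0, hA, hB, hM⟩ := one_dim (m + 1 + l) ψ hψsmooth.continuous hψrange
    hψsupp hψone hk hL h10 hlog
  have hlow := lower (m + 1 + l) hk ψ (gf (m + 1 + l) ψ) hψsmooth.continuous hψrange hψone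
    hI2 hI3 hM
  have hup := upper m l (gf (m + 1 + l) ψ)
  have e1 : ∀ t, F1 (m + 1 + l) ψ t = ∏ i, gf (m + 1 + l) ψ (t i) := fun t => rfl
  have e2 : ∀ t, Ffun (m + 1 + l) ψ t = ψ (∑ i, t i) * ∏ i, gf (m + 1 + l) ψ (t i) :=
    fun t => rfl
  simp only [e1, e2]
  rw [hup]
  clear hup e1 e2 hI2 hI3 hM
  have hk0 : (0:ℝ) < ((m + 1 + l : ℕ) : ℝ) := by exact_mod_cast hk
  generalize ((m + 1 + l : ℕ) : ℝ) = K at *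
  generalize (∫ t in Set.Ici 0, gf (m + 1 + l) ψ t) = A at *
  generalize (∫ t in Set.Ici 0, gf (m + 1 + l) ψ t ^ 2) = B at *
  have hBpos : 0 < B := lt_of_lt_of_le (by positivity) hB
  have hAB : A ^ 2 ≤ 2 * (Real.log K / K) * B := by
    calc A ^ 2 ≤ (1 / K) ^ 2 := by gcongr
      _ ≤ 2 * (Real.log K / K) * ((9/10) / (K * Real.log K)) := by
          have : 2 * (Real.log K / K) * ((9/10) / (K * Real.log K)) = (9/5) * (1 / K) ^ 2 := by
            field_simp; norm_num
          rw [this]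
          nlinarith [sq_nonneg (1 / K)]
      _ ≤ _ := by gcongr
  calc A ^ (2 * (m + 1)) * B ^ l = (A ^ 2) ^ (m + 1) * B ^ l := by rw [pow_mul]
    _ ≤ (2 * (Real.log K / K) * B) ^ (m + 1) * B ^ l := by gcongr
    _ = 4 * 2 ^ (m + 1) * (Real.log K ^ (m + 1) / K ^ (m + 1)) * ((1/4) * B ^ (m + 1 + l)) := by
        rw [pow_add B, mul_pow, mul_pow, div_pow]; ring
    _ ≤ _ := by gcongr

end Sieve
end
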